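/- Let α, β : [0,1] → ℝⁿ be continuously differentiable paths and M ≥ 0 a constant such that ‖α'(t)‖ ≤ M and ‖β'(t)‖ ≤ M for all t ∈ [0,1] (Euclidean norm). Then for every k ≥ 1 and all indices i₁,…,i_k ∈ {1,…,n}, |S_{i₁⋯i_k}(α) − S_{i₁⋯i_k}(β)| ≤ (M^{k−1}/(k−1)!) · ∫₀¹ ‖α'(t) − β'(t)‖ dt. (This quantitative Lipschitz estimate is the core of the local Lipschitz continuity of the signature map on paths of bounded length.) -/

import Mathlib

open MeasureTheory

/-- The signature coefficient `S_{i₁⋯i_k}(γ)` of a path `γ : ℝ → ℝⁿ`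
(Euclidean space, restricted to `[0,1]`). -/
noncomputable def sigCoeffE {n : ℕ} (γ : ℝ → EuclideanSpace ℝ (Fin n)) {k : ℕ}
    (idx : Fin k → Fin n) : ℝ :=
  ∫ u in {u : Fin k → ℝ | StrictMono u ∧ ∀ i, u i ∈ Set.Ioo (0:ℝ) 1},
    ∏ i, deriv (fun t => γ t (idx i)) (u i)

theorem abs_prod_le_pow {M : ℝ} {k : ℕ} (f : Fin k → ℝ) (hf : ∀ i, |f i| ≤ M) :
    |∏ i, f i| ≤ M ^ k := by
  rw [Finset.abs_prod]
  simpa using Finset.prod_le_prod (s := Finset.univ) (fun i _ => abs_nonneg (f i)) fun i _ => hf i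

/-- A telescoping bound for the difference of two products of factors bounded by `M`. -/
theorem abs_prod_sub_prod_le {M : ℝ} (hM : 0 ≤ M) {m : ℕ} (f g : Fin (m + 1) → ℝ)
    (hf : ∀ i, |f i| ≤ M) (hg : ∀ i, |g i| ≤ M) :
    |∏ i, f i - ∏ i, g i| ≤ M ^ m * ∑ i, |f i - g i| := by
  induction m with
  | zero => simp
  | succ m ih =>
    rw [Fin.prod_univ_succ f, Fin.prod_univ_succ g, Fin.sum_univ_succ]
    have hP : |∏ i : Fin (m + 1), f i.succ| ≤ M ^ (m + 1) := abs_prod_le_pow _ fun i => hf _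
    have hPQ := ih (fun i => f i.succ) (fun i => g i.succ) (fun i => hf _) fun i => hg _
    calc
      _ = |(f 0 - g 0) * ∏ i : Fin (m + 1), f i.succ
            + g 0 * (∏ i : Fin (m + 1), f i.succ - ∏ i : Fin (m + 1), g i.succ)| := by
        congr 1; ring
      _ ≤ |f 0 - g 0| * |∏ i : Fin (m + 1), f i.succ|
            + |g 0| * |∏ i : Fin (m + 1), f i.succ - ∏ i : Fin (m + 1), g i.succ| := by
        rw [← abs_mul, ← abs_mul]; exact abs_add_le _ _
      _ ≤ |f 0 - g 0| * M ^ (m + 1)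
            + M * (M ^ m * ∑ i : Fin (m + 1), |f i.succ - g i.succ|) := by
        gcongr; exact hg 0
      _ = _ := by ring

/-- The open simplex of strictly increasing tuples in `(0,1)`. -/
def openSimplex (k : ℕ) : Set (Fin k → ℝ) :=
  {u | StrictMono u ∧ ∀ i, u i ∈ Set.Ioo (0:ℝ) 1}

theorem measurableSet_openSimplex (k : ℕ) : MeasurableSet (openSimplex k) := by
  have h : openSimplex k = (⋂ (i : Fin k) (j : Fin k) (_ : i < j), {u | u i < u j}) ∩
      ⋂ i, (fun u : Fin k → ℝ => u i) ⁻¹' Set.Ioo 0 1 := by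
    ext u; simp [openSimplex, StrictMono]
  rw [h]
  refine .inter (.iInter fun i => .iInter fun j => .iInter fun _ => ?_) (.iInter fun i => ?_)
  · exact measurableSet_lt (measurable_pi_apply i) (measurable_pi_apply j)
  · exact measurable_pi_apply i measurableSet_Ioo

theorem openSimplex_subset (k : ℕ) :
    openSimplex k ⊆ Set.univ.pi fun _ : Fin k => Set.Ioo (0:ℝ) 1 :=
  fun _ hu i _ => hu.2 i

theorem measurePreserving_comp_perm {k : ℕ} (σ : Equiv.Perm (Fin k)) :
    MeasurePreserving (MeasurableEquiv.piCongrLeft (fun _ : Fin k => ℝ) σ) volume volume :=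
  volume_measurePreserving_piCongrLeft (fun _ : Fin k => ℝ) σ

theorem piCongrLeft_perm_apply {k : ℕ} (σ : Equiv.Perm (Fin k)) (u : Fin k → ℝ) :
    MeasurableEquiv.piCongrLeft (fun _ : Fin k => ℝ) σ u = u ∘ σ.symm := by
  ext i
  obtain ⟨j, rfl⟩ := σ.surjective i
  simp [MeasurableEquiv.coe_piCongrLeft, Equiv.piCongrLeft_apply_apply]

theorem perm_eq_of_strictMono_comp {k : ℕ} {u : Fin k → ℝ} {σ τ : Equiv.Perm (Fin k)}
    (hσ : StrictMono (u ∘ σ)) (hτ : StrictMono (u ∘ τ)) : σ = τ := by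
  have hmono : StrictMono (τ.symm * σ : Equiv.Perm (Fin k)) := fun i j hij => by
    rw [← hτ.lt_iff_lt]
    simpa using hσ hij
  have h : (τ.symm * σ : Equiv.Perm (Fin k)) = 1 := by
    ext i
    have := Subsingleton.elim (hmono.orderIsoOfSurjective _ (Equiv.surjective _)) (OrderIso.refl _)
    exact congrArg Fin.val (DFunLike.congr_fun this i)
  ext i
  have := congrArg τ (DFunLike.congr_fun h i)
  simpa using congrArg Fin.val this

/-- A nonnegative symmetric function integrates over the open simplex to at most `1 / k!` times
its integral over the cube. -/
theorem factorial_mul_setIntegral_openSimplex_le {k : ℕ} (F : (Fin k → ℝ) → ℝ)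
    (hF : ∀ u ∈ Set.univ.pi fun _ : Fin k => Set.Ioo (0:ℝ) 1, 0 ≤ F u)
    (hsymm : ∀ (σ : Equiv.Perm (Fin k)) u, F (u ∘ σ) = F u)
    (hint : IntegrableOn F (Set.univ.pi fun _ : Fin k => Set.Ioo (0:ℝ) 1)) :
    (k.factorial : ℝ) * ∫ u in openSimplex k, F u ≤
      ∫ u in Set.univ.pi fun _ : Fin k => Set.Ioo (0:ℝ) 1, F u := by
  set e := fun σ : Equiv.Perm (Fin k) => MeasurableEquiv.piCongrLeft (fun _ : Fin k => ℝ) σ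
  have hcube (σ) : e σ ⁻¹' openSimplex k ⊆ Set.univ.pi fun _ : Fin k => Set.Ioo (0:ℝ) 1 := by
    intro u hu i _
    have := (show e σ u ∈ openSimplex k from hu).2 (σ i)
    simpa [e, piCongrLeft_perm_apply] using this
  have heq (σ) : ∫ u in e σ ⁻¹' openSimplex k, F u = ∫ u in openSimplex k, F u := by
    rw [← (measurePreserving_comp_perm σ).setIntegral_preimage_emb
      (e σ).measurableEmbedding F (openSimplex k)]
    refine setIntegral_congr_fun ((e σ).measurable (measurableSet_openSimplex k)) fun u _ => ?_
    rw [piCongrLeft_perm_apply, hsymm]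
  have hdisj : Pairwise (Function.onFun Disjoint fun σ => e σ ⁻¹' openSimplex k) := by
    intro σ τ hne
    refine Set.disjoint_left.2 fun u hu hv => hne ?_
    have hu : e σ u ∈ openSimplex k := hu
    have hv : e τ u ∈ openSimplex k := hv
    simp only [e, piCongrLeft_perm_apply] at hu hv
    exact Equiv.symm_bijective.injective (perm_eq_of_strictMono_comp hu.1 hv.1)
  calc
    _ = ∑ σ, ∫ u in e σ ⁻¹' openSimplex k, F u := by
      simp [heq, Fintype.card_perm]
    _ = ∫ u in ⋃ σ, e σ ⁻¹' openSimplex k, F u :=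
      (integral_iUnion_fintype (fun σ => (e σ).measurable (measurableSet_openSimplex k)) hdisj
        fun σ => hint.mono_set (hcube σ)).symm
    _ ≤ _ := setIntegral_mono_set hint
      (ae_restrict_of_forall_mem (.univ_pi fun _ => measurableSet_Ioo) hF)
      (Set.iUnion_subset hcube).eventuallyLE

theorem integrableOn_cube_eval {k : ℕ} {D : ℝ → ℝ} (hD : IntegrableOn D (Set.Ioo 0 1))
    (i : Fin k) :
    IntegrableOn (fun u => D (u i)) (Set.univ.pi fun _ : Fin k => Set.Ioo (0:ℝ) 1) := by
  have : IsProbabilityMeasure (volume.restrict (Set.Ioo (0:ℝ) 1)) := ⟨by simp⟩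
  rw [IntegrableOn, volume_pi, Measure.restrict_pi_pi]
  exact (measurePreserving_eval (fun _ : Fin k => volume.restrict (Set.Ioo (0:ℝ) 1)) i
    ).integrable_comp_of_integrable hD

theorem setIntegral_cube_eval {k : ℕ} {D : ℝ → ℝ} (hD : IntegrableOn D (Set.Ioo 0 1))
    (i : Fin k) :
    ∫ u in Set.univ.pi fun _ : Fin k => Set.Ioo (0:ℝ) 1, D (u i) = ∫ t in Set.Ioo 0 1, D t := by
  have : IsProbabilityMeasure (volume.restrict (Set.Ioo (0:ℝ) 1)) := ⟨by simp⟩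
  rw [volume_pi, Measure.restrict_pi_pi]
  exact integral_comp_eval (μ := fun _ : Fin k => volume.restrict (Set.Ioo (0:ℝ) 1))
    hD.aestronglyMeasurable

theorem setIntegral_openSimplex_sum_le {m : ℕ} {D : ℝ → ℝ} (hD0 : ∀ t, 0 ≤ D t)
    (hD : IntegrableOn D (Set.Ioo 0 1)) :
    ∫ u in openSimplex (m + 1), ∑ i, D (u i) ≤ (∫ t in Set.Ioo 0 1, D t) / m.factorial := by
  have h := factorial_mul_setIntegral_openSimplex_le (k := m + 1) (fun u => ∑ i, D (u i))
    (fun u _ => Finset.sum_nonneg fun i _ => hD0 _)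
    (fun σ u => Equiv.sum_comp σ fun i => D (u i))
    (integrable_finsetSum _ fun i _ => integrableOn_cube_eval hD i)
  rw [integral_finsetSum _ fun i _ => integrableOn_cube_eval hD i] at h
  simp only [setIntegral_cube_eval hD, Finset.sum_const, Finset.card_univ, Fintype.card_fin,
    nsmul_eq_mul, Nat.factorial_succ, Nat.cast_mul, mul_assoc] at h
  rw [le_div_iff₀ (by positivity), mul_comm]
  exact le_of_mul_le_mul_left h (by positivity)

theorem deriv_euclidean_apply {n : ℕ} {γ : ℝ → EuclideanSpace ℝ (Fin n)} {t : ℝ}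
    (h : DifferentiableAt ℝ γ t) (i : Fin n) : deriv (fun s => γ s i) t = deriv γ t i :=
  ((EuclideanSpace.proj (𝕜 := ℝ) i).hasFDerivAt.comp_hasDerivAt t h.hasDerivAt).deriv

theorem differentiableAt_of_contDiffOn_Icc {n : ℕ} {γ : ℝ → EuclideanSpace ℝ (Fin n)}
    (h : ContDiffOn ℝ 1 γ (Set.Icc 0 1)) {t : ℝ} (ht : t ∈ Set.Ioo (0:ℝ) 1) :
    DifferentiableAt ℝ γ t :=
  (h.contDiffAt (Icc_mem_nhds ht.1 ht.2)).differentiableAt one_ne_zero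

theorem abs_deriv_apply_le {n : ℕ} {γ : ℝ → EuclideanSpace ℝ (Fin n)} {M : ℝ}
    (h : ContDiffOn ℝ 1 γ (Set.Icc 0 1)) (hM : ∀ t ∈ Set.Icc (0:ℝ) 1, ‖deriv γ t‖ ≤ M)
    {t : ℝ} (ht : t ∈ Set.Ioo (0:ℝ) 1) (i : Fin n) : |deriv (fun s => γ s i) t| ≤ M := by
  rw [deriv_euclidean_apply (differentiableAt_of_contDiffOn_Icc h ht)]
  exact (PiLp.norm_apply_le (deriv γ t) i).trans (hM t (Set.Ioo_subset_Icc_self ht))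

theorem integrableOn_openSimplex_prod_deriv {n : ℕ} {γ : ℝ → EuclideanSpace ℝ (Fin n)} {M : ℝ}
    (h : ContDiffOn ℝ 1 γ (Set.Icc 0 1)) (hM : ∀ t ∈ Set.Icc (0:ℝ) 1, ‖deriv γ t‖ ≤ M)
    {k : ℕ} (idx : Fin k → Fin n) :
    IntegrableOn (fun u => ∏ i, deriv (fun t => γ t (idx i)) (u i)) (openSimplex k) := by
  have hfin : volume (openSimplex k) < ⊤ :=
    (measure_mono (openSimplex_subset k)).trans_lt (by simp [volume_pi_pi])
  refine IntegrableOn.of_bound hfin (C := M ^ k) ?_ ?_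
  · refine (Finset.measurable_prod _ fun i _ => ?_).aestronglyMeasurable
    exact (measurable_deriv _).comp (measurable_pi_apply i)
  · refine ae_restrict_of_forall_mem (measurableSet_openSimplex k) fun u hu => ?_
    exact abs_prod_le_pow _ fun i => abs_deriv_apply_le h hM (hu.2 i) (idx i)

/-- Quantitative Lipschitz estimate for signature coefficients: if
`‖α'‖, ‖β'‖ ≤ M` on `[0,1]`, then
`|S_{i₁⋯i_k}(α) − S_{i₁⋯i_k}(β)| ≤ (M^{k−1}/(k−1)!) ∫₀¹ ‖α'(t) − β'(t)‖ dt`. -/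
theorem signature_lipschitz {n : ℕ} (α β : ℝ → EuclideanSpace ℝ (Fin n))
    (hα : ContDiffOn ℝ 1 α (Set.Icc 0 1)) (hβ : ContDiffOn ℝ 1 β (Set.Icc 0 1))
    (M : ℝ) (hM : 0 ≤ M)
    (hαM : ∀ t ∈ Set.Icc (0:ℝ) 1, ‖deriv α t‖ ≤ M)
    (hβM : ∀ t ∈ Set.Icc (0:ℝ) 1, ‖deriv β t‖ ≤ M)
    {k : ℕ} (hk : 1 ≤ k) (idx : Fin k → Fin n) :
    |sigCoeffE α idx - sigCoeffE β idx| ≤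
      (M ^ (k - 1) / (Nat.factorial (k - 1) : ℝ)) *
        ∫ t in (0:ℝ)..1, ‖deriv α t - deriv β t‖ := by
  obtain ⟨m, rfl⟩ := Nat.exists_eq_add_of_le' hk
  rw [Nat.add_sub_cancel, intervalIntegral.integral_of_le zero_le_one, integral_Ioc_eq_integral_Ioo]
  set D : ℝ → ℝ := fun t => ‖deriv α t - deriv β t‖
  have hD : IntegrableOn D (Set.Ioo 0 1) := by
    refine IntegrableOn.of_bound (by simp) (C := M + M)
      ((measurable_deriv α).sub (measurable_deriv β)).norm.aestronglyMeasurable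
      (ae_restrict_of_forall_mem measurableSet_Ioo fun t ht => ?_)
    have ht := Set.Ioo_subset_Icc_self ht
    simpa [D] using (norm_sub_le _ _).trans (add_le_add (hαM t ht) (hβM t ht))
  have hsum : IntegrableOn (fun u => ∑ i, D (u i)) (openSimplex (m + 1)) :=
    integrable_finsetSum _ fun i _ =>
      (integrableOn_cube_eval hD i).mono_set (openSimplex_subset _)
  have hbound : ∀ u ∈ openSimplex (m + 1),
      ‖∏ i, deriv (fun t => α t (idx i)) (u i) - ∏ i, deriv (fun t => β t (idx i)) (u i)‖
        ≤ M ^ m * ∑ i, D (u i) := fun u hu => by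
    refine (abs_prod_sub_prod_le hM _ _ (fun i => abs_deriv_apply_le hα hαM (hu.2 i) _)
      fun i => abs_deriv_apply_le hβ hβM (hu.2 i) _).trans ?_
    gcongr with i
    rw [deriv_euclidean_apply (differentiableAt_of_contDiffOn_Icc hα (hu.2 i)),
      deriv_euclidean_apply (differentiableAt_of_contDiffOn_Icc hβ (hu.2 i))]
    exact PiLp.norm_apply_le (deriv α (u i) - deriv β (u i)) (idx i)
  calc
    |sigCoeffE α idx - sigCoeffE β idx|
      = ‖∫ u in openSimplex (m + 1), (∏ i, deriv (fun t => α t (idx i)) (u i)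
          - ∏ i, deriv (fun t => β t (idx i)) (u i))‖ := by
        rw [integral_sub (integrableOn_openSimplex_prod_deriv hα hαM idx)
          (integrableOn_openSimplex_prod_deriv hβ hβM idx)]
        rfl
    _ ≤ ∫ u in openSimplex (m + 1), M ^ m * ∑ i, D (u i) :=
        norm_integral_le_of_norm_le (hsum.const_mul _)
          (ae_restrict_of_forall_mem (measurableSet_openSimplex _) hbound)
    _ = M ^ m * ∫ u in openSimplex (m + 1), ∑ i, D (u i) := integral_const_mul _ _
    _ ≤ M ^ m * ((∫ t in Set.Ioo 0 1, D t) / m.factorial) := by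
        gcongr
        exact setIntegral_openSimplex_sum_le (fun t => norm_nonneg _) hD
    _ = _ := by ring
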